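/- Let n ≥ 20 be an integer, let P_n(x) = 512(2−n)x⁶ + 4(n³−60n²+670n−1344)x⁵ − 2(13n³−424n²+3064n−5408)x⁴ + 2(27n³−572n²+3264n−5440)x³ − (49n³−772n²+3776n−5888)x² + 4(5n³−66n²+288n−416)x − 3(n³−12n²+48n−64), and let p* be the smallest real root of P_n greater than (n−4)/(n−8). Then the interval (n/(n−8), 1 + 8p*/(n−4)) is nonempty, and for every p in this interval there exists γ ∈ (1, 3/2) such that both p(1 − 4(γ−1)²) − γ²/(2γ−1) + 8γ²(γ−1)²/((4γ−3+p)(p+1)) > 0 and p < (8γ + n − 4)/(n−4) hold. -/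

import Mathlib

open MeasureTheory Real RealInnerProductSpace

/-- The Laplacian of `f : ℝⁿ → ℝ`, as the trace of the second derivative. -/
noncomputable def lap {n : ℕ} (f : EuclideanSpace ℝ (Fin n) → ℝ)
    (x : EuclideanSpace ℝ (Fin n)) : ℝ :=
  ∑ i : Fin n,
    iteratedFDeriv ℝ 2 f x ![EuclideanSpace.single i 1, EuclideanSpace.single i 1]

/-- Squared Frobenius norm of the Hessian of `f : ℝⁿ → ℝ`. -/
noncomputable def hessNormSq {n : ℕ} (f : EuclideanSpace ℝ (Fin n) → ℝ)
    (x : EuclideanSpace ℝ (Fin n)) : ℝ :=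
  ∑ i : Fin n, ∑ j : Fin n,
    (iteratedFDeriv ℝ 2 f x ![EuclideanSpace.single i 1, EuclideanSpace.single j 1]) ^ 2

/-- The quantity `‖∇⁴(φ^{2γ})‖` defined by
`‖∇⁴(φ^{2γ})‖² = φ^{-2γ}|∇φ^γ|⁴ + |φ^γ Δ²φ^γ| + |∇²φ^γ|²`,
with the first term interpreted as `0` where `φ = 0`. -/
noncomputable def norm4 {n : ℕ} (γ : ℝ) (φ : EuclideanSpace ℝ (Fin n) → ℝ)
    (x : EuclideanSpace ℝ (Fin n)) : ℝ :=
  Real.sqrt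
    ((if φ x = 0 then 0 else φ x ^ (-(2*γ)) * ‖gradient (fun y => φ y ^ γ) x‖ ^ 4)
      + |φ x ^ γ * lap (lap (fun y => φ y ^ γ)) x|
      + hessNormSq (fun y => φ y ^ γ) x)

/-- The degree-6 polynomial from the paper whose smallest root above `(n-4)/(n-8)`
defines the exponent `p*`. -/
noncomputable def Pn (n : ℕ) (x : ℝ) : ℝ :=
  512*(2-(n:ℝ))*x^6 + 4*((n:ℝ)^3-60*(n:ℝ)^2+670*(n:ℝ)-1344)*x^5
    - 2*(13*(n:ℝ)^3-424*(n:ℝ)^2+3064*(n:ℝ)-5408)*x^4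
    + 2*(27*(n:ℝ)^3-572*(n:ℝ)^2+3264*(n:ℝ)-5440)*x^3
    - (49*(n:ℝ)^3-772*(n:ℝ)^2+3776*(n:ℝ)-5888)*x^2
    + 4*(5*(n:ℝ)^3-66*(n:ℝ)^2+288*(n:ℝ)-416)*x
    - 3*((n:ℝ)^3-12*(n:ℝ)^2+48*(n:ℝ)-64)

lemma Pn_neg_of_le {n : ℕ} (hn : 20 ≤ n) (hn' : n ≤ 36) {x : ℝ}
    (hx : ((n : ℝ) - 4) / ((n : ℝ) - 8) < x) : Pn n x < 0 := by
  obtain ⟨s, hs, rfl⟩ : ∃ s : ℝ, 0 < s ∧ x = ((n : ℝ) - 4) / ((n : ℝ) - 8) + s :=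
    ⟨_, sub_pos.2 hx, by ring⟩
  have h2 := pow_pos hs 2
  have h3 := pow_pos hs 3
  have h4 := pow_pos hs 4
  have h5 := pow_pos hs 5
  have h6 := pow_pos hs 6
  unfold Pn
  interval_cases n <;> norm_num <;> linarith

lemma Pn_left_pos {n : ℕ} (hn : 37 ≤ n) : 0 < Pn n (((n : ℝ) - 4) / ((n : ℝ) - 8)) := by
  obtain ⟨m, rfl⟩ := Nat.exists_eq_add_of_le hn
  have h : (0 : ℝ) < m + 29 := by positivity
  have key : Pn (37 + m) ((((37 + m : ℕ) : ℝ) - 4) / (((37 + m : ℕ) : ℝ) - 8)) =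
      (8 * (m : ℝ) ^ 8 + 1896 * m ^ 7 + 192632 * m ^ 6 + 10879112 * m ^ 5 + 369067176 * m ^ 4
        + 7530599736 * m ^ 3 + 85901896872 * m ^ 2 + 430478973144 * m + 134853448752)
        / (m + 29) ^ 6 := by
    have e4 : ((37 + m : ℕ) : ℝ) - 4 = m + 33 := by push_cast; ring
    have e8 : ((37 + m : ℕ) : ℝ) - 8 = m + 29 := by push_cast; ring
    rw [e4, e8]
    unfold Pn
    push_cast
    field_simp
    ring
  rw [key]
  positivity

lemma Pn_three_halves_neg (n : ℕ) : Pn n (3 / 2) < 0 := by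
  have key : Pn n (3 / 2) =
      -(9 / 4 * (n : ℝ) ^ 3 + 27 / 2 * n ^ 2 + 5535 / 4 * n + 180) := by
    unfold Pn
    ring
  rw [key, neg_lt_zero]
  positivity

lemma exists_root_of_nonpos {n : ℕ} {a b : ℝ} (hab : a ≤ b) (ha : 0 < Pn n a)
    (hb : Pn n b ≤ 0) : ∃ y, (a < y ∧ y ≤ b) ∧ Pn n y = 0 := by
  have hc : Continuous (Pn n) := by
    unfold Pn
    fun_prop
  obtain ⟨y, hy, hy0⟩ := intermediate_value_Icc' hab hc.continuousOn ⟨hb, ha.le⟩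
  refine ⟨y, ⟨hy.1.lt_of_ne ?_, hy.2⟩, hy0⟩
  rintro rfl
  exact ha.ne' hy0

/-- On the line `p = 1 + 8γ/(n-4)`, clearing denominators in the expression below gives
`4 Pn n γ + 800 n γ⁵`. -/
lemma expr_pos_of_Pn_pos {n : ℕ} (hn : (4 : ℝ) < n) {x : ℝ} (hx : 1 < x) (hP : 0 < Pn n x) :
    0 < (1 + 8 * x / ((n : ℝ) - 4)) * (1 - 4 * (x - 1) ^ 2) - x ^ 2 / (2 * x - 1)
      + 8 * x ^ 2 * (x - 1) ^ 2 /
        ((4 * x - 3 + (1 + 8 * x / ((n : ℝ) - 4))) * (1 + 8 * x / ((n : ℝ) - 4) + 1)) := by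
  have h4 : (0 : ℝ) < n - 4 := by linarith
  have hq : 0 < 8 * x / ((n : ℝ) - 4) := by positivity
  have h1 : 0 < 2 * x - 1 := by linarith
  have h2 : 0 < 4 * x - 3 + (1 + 8 * x / ((n : ℝ) - 4)) := by linarith
  have h3 : 0 < 1 + 8 * x / ((n : ℝ) - 4) + 1 := by linarith
  have key : ((1 + 8 * x / ((n : ℝ) - 4)) * (1 - 4 * (x - 1) ^ 2) * (2 * x - 1)
      * ((4 * x - 3 + (1 + 8 * x / ((n : ℝ) - 4))) * (1 + 8 * x / ((n : ℝ) - 4) + 1))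
      - x ^ 2 * ((4 * x - 3 + (1 + 8 * x / ((n : ℝ) - 4))) * (1 + 8 * x / ((n : ℝ) - 4) + 1))
      + 8 * x ^ 2 * (x - 1) ^ 2 * (2 * x - 1))
      = (4 * Pn n x + 800 * n * x ^ 5) / ((n : ℝ) - 4) ^ 3 := by
    unfold Pn
    field_simp
    ring
  generalize 8 * x / ((n : ℝ) - 4) = q at *
  have hdiv : (1 + q) * (1 - 4 * (x - 1) ^ 2) - x ^ 2 / (2 * x - 1)
      + 8 * x ^ 2 * (x - 1) ^ 2 / ((4 * x - 3 + (1 + q)) * (1 + q + 1))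
      = (4 * Pn n x + 800 * n * x ^ 5) / ((n : ℝ) - 4) ^ 3
        / ((2 * x - 1) * ((4 * x - 3 + (1 + q)) * (1 + q + 1))) := by
    rw [← key, sub_div' h1.ne', div_add_div _ _ h1.ne' (mul_pos h2 h3).ne']
    ring
  rw [hdiv]
  positivity

theorem stmt_19 (n : ℕ) (hn : 20 ≤ n) (pstar : ℝ)
    (hroot : Pn n pstar = 0)
    (hgt : ((n : ℝ) - 4)/((n : ℝ) - 8) < pstar)
    (hmin : ∀ x : ℝ, ((n : ℝ) - 4)/((n : ℝ) - 8) < x → Pn n x = 0 → pstar ≤ x) :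
    (n : ℝ)/((n : ℝ) - 8) < 1 + 8*pstar/((n : ℝ) - 4) ∧
    ∀ p : ℝ, (n : ℝ)/((n : ℝ) - 8) < p → p < 1 + 8*pstar/((n : ℝ) - 4) →
      ∃ γ : ℝ, 1 < γ ∧ γ < 3/2 ∧
        0 < p*(1 - 4*(γ-1)^2) - γ^2/(2*γ-1) + 8*γ^2*(γ-1)^2/((4*γ-3+p)*(p+1)) ∧
        p < (8*γ + (n : ℝ) - 4)/((n : ℝ) - 4) := by
  have hn' : (20 : ℝ) ≤ n := by exact_mod_cast hn
  have h4 : (0 : ℝ) < n - 4 := by linarith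
  have h8 : (0 : ℝ) < n - 8 := by linarith
  have hn37 : 37 ≤ n := by
    by_contra! h
    exact (Pn_neg_of_le hn (by omega) hgt).ne hroot
  have hpos : ∀ x, ((n : ℝ) - 4) / (n - 8) < x → x < pstar → 0 < Pn n x := by
    intro x hx hxp
    by_contra! hle
    obtain ⟨y, hy, hy0⟩ := exists_root_of_nonpos hx.le (Pn_left_pos hn37) hle
    exact absurd (hmin y hy.1 hy0) (by linarith [hy.2])
  have hp32 : pstar ≤ 3 / 2 := by
    have ha : ((n : ℝ) - 4) / (n - 8) ≤ 3 / 2 := by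
      rw [div_le_iff₀ h8]
      linarith
    obtain ⟨y, hy, hy0⟩ :=
      exists_root_of_nonpos ha (Pn_left_pos hn37) (Pn_three_halves_neg n).le
    exact (hmin y hy.1 hy0).trans hy.2
  have hn8 : (n : ℝ) / (n - 8) = 1 + 8 * (((n : ℝ) - 4) / (n - 8)) / (n - 4) := by
    field_simp
    ring
  refine ⟨?_, fun p hp hp' => ?_⟩
  · rw [hn8]
    gcongr
  obtain ⟨x, rfl⟩ : ∃ x : ℝ, p = 1 + 8 * x / (n - 4) :=
    ⟨(p - 1) * (n - 4) / 8, by field_simp; ring⟩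
  have hax : ((n : ℝ) - 4) / (n - 8) < x := by
    by_contra! h
    refine hp.not_ge ?_
    rw [hn8]
    gcongr
  have hxp : x < pstar := by
    by_contra! h
    refine hp'.not_ge ?_
    gcongr
  have hx1 : 1 < x := lt_trans (by rw [one_lt_div h8]; linarith) hax
  have hq : 0 < 8 * x / ((n : ℝ) - 4) := by positivity
  have hF := expr_pos_of_Pn_pos (by linarith) hx1 (hpos x hax hxp)
  have hcont : ContinuousAt (fun γ : ℝ => (1 + 8 * x / ((n : ℝ) - 4)) * (1 - 4 * (γ - 1) ^ 2)
      - γ ^ 2 / (2 * γ - 1) + 8 * γ ^ 2 * (γ - 1) ^ 2 /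
        ((4 * γ - 3 + (1 + 8 * x / ((n : ℝ) - 4))) * (1 + 8 * x / ((n : ℝ) - 4) + 1))) x := by
    refine ContinuousAt.add (ContinuousAt.sub (by fun_prop) ?_) ?_
    · exact ContinuousAt.div (by fun_prop) (by fun_prop) (by linarith)
    · refine ContinuousAt.div (by fun_prop) (by fun_prop) (mul_pos ?_ ?_).ne' <;> linarith
  obtain ⟨γ, hγF, hxγ, hγ⟩ :=
    (((hcont.eventually (lt_mem_nhds hF)).filter_mono nhdsWithin_le_nhds).and
      (Ioo_mem_nhdsGT (hxp.trans_le hp32))).exists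
  refine ⟨γ, hx1.trans hxγ, hγ, hγF, ?_⟩
  rw [add_sub_assoc, add_div, div_self h4.ne', add_comm]
  gcongr
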